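/- arXiv:2302.05661 — 5 statements merged into one kernel-verified Lean document; each statement's English description precedes it below -/
import Mathlib

section
/- Let $k_3, k_4$ be integers with $6 \le k_3 < k_4$, and let $x > 1$ be the (unique) real number satisfying $2\arcsin(\cos(\pi/3)/x) + 2\arcsin(\cos(\pi/5)/x) + 2\arcsin(\cos(\pi/k_3)/x) + 2\arcsin(\cos(\pi/k_4)/x) = 2\pi$. Then $1.1 \le x \le 1.2$. -/
open Real

/-- If the arcsines of four numbers in `[-1, 1]` sum to `π`, then the cosines of the sums of
the two pairs of angles are opposite. -/
lemma sqrt_mul_sqrt_add_eq_of_arcsin_add_eq_pi {a b c d : ℝ} (ha : a ∈ Set.Icc (-1) 1)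
    (hb : b ∈ Set.Icc (-1) 1) (hc : c ∈ Set.Icc (-1) 1) (hd : d ∈ Set.Icc (-1) 1)
    (h : arcsin a + arcsin b + arcsin c + arcsin d = π) :
    √(1 - a ^ 2) * √(1 - b ^ 2) + √(1 - c ^ 2) * √(1 - d ^ 2) = a * b + c * d := by
  have key : cos (arcsin a + arcsin b) = -cos (arcsin c + arcsin d) := by
    rw [← cos_pi_sub]
    congr 1
    linarith
  rw [cos_add, cos_add, cos_arcsin, cos_arcsin, cos_arcsin, cos_arcsin,
    sin_arcsin ha.1 ha.2, sin_arcsin hb.1 hb.2, sin_arcsin hc.1 hc.2, sin_arcsin hd.1 hd.2] at key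
  linarith

lemma sqrt_one_sub_sq_le {s s₀ c : ℝ} (hs₀ : 0 ≤ s₀) (hs : s₀ ≤ s) (hc : 0 ≤ c)
    (h : 1 - s₀ ^ 2 ≤ c ^ 2) : √(1 - s ^ 2) ≤ c :=
  sqrt_le_iff.2 ⟨hc, by nlinarith⟩

lemma le_sqrt_one_sub_sq {s s₀ c : ℝ} (hs : 0 ≤ s) (hs₀ : s ≤ s₀)
    (h : c ^ 2 ≤ 1 - s₀ ^ 2) : c ≤ √(1 - s ^ 2) :=
  le_sqrt_of_sq_le (by nlinarith)

lemma cos_pi_div_le_cos_pi_div {m k : ℝ} (hm : 1 ≤ m) (hmk : m ≤ k) :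
    cos (π / m) ≤ cos (π / k) := by
  have hm₀ : 0 < m := by linarith
  exact cos_le_cos_of_nonneg_of_le_pi (div_nonneg pi_pos.le (by linarith))
    (div_le_self pi_pos.le hm) (div_le_div_of_nonneg_left pi_pos.le hm₀ hmk)

lemma cos_pi_div_six_gt : 0.866 < cos (π / 6) := by
  rw [cos_pi_div_six]
  have : (1.732 : ℝ) < √3 := lt_sqrt_of_sq_lt (by norm_num)
  linarith

lemma cos_pi_div_seven_gt : 0.899 < cos (π / 7) := by
  have h := one_sub_sq_div_two_le_cos (x := π / 7)
  nlinarith [pi_lt_d4, pi_pos]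

lemma cos_pi_div_five_bounds : 0.809 < cos (π / 5) ∧ cos (π / 5) < 0.80902 := by
  rw [cos_pi_div_five]
  have h₁ : (2.236 : ℝ) < √5 := lt_sqrt_of_sq_lt (by norm_num)
  have h₂ : √5 < (2.23607 : ℝ) := (sqrt_lt' (by norm_num)).2 (by norm_num)
  constructor <;> linarith

/-- The side-length parameter `x = cosh(ℓ/2)` of the fan of type `[3, 5, k₃, k₄]`
with `6 ≤ k₃ < k₄` lies in the interval `[1.1, 1.2]`. -/
theorem stmt_0 (k₃ k₄ : ℤ) (hk₃ : 6 ≤ k₃) (hk₃k₄ : k₃ < k₄)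
    (x : ℝ) (hx : 1 < x)
    (heq : 2 * arcsin (cos (π / 3) / x) + 2 * arcsin (cos (π / 5) / x)
        + 2 * arcsin (cos (π / (k₃ : ℝ)) / x) + 2 * arcsin (cos (π / (k₄ : ℝ)) / x)
        = 2 * π) :
    1.1 ≤ x ∧ x ≤ 1.2 := by
  have hx₀ : 0 < x := by linarith
  have hk₃' : (6 : ℝ) ≤ k₃ := by exact_mod_cast hk₃
  have hk₄' : (7 : ℝ) ≤ k₄ := by exact_mod_cast (by omega : 7 ≤ k₄)
  have mem (θ : ℝ) : cos θ / x ∈ Set.Icc (-1) 1 := by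
    rw [Set.mem_Icc, le_div_iff₀ hx₀, div_le_iff₀ hx₀]
    constructor <;> linarith [neg_one_le_cos θ, cos_le_one θ]
  have key := sqrt_mul_sqrt_add_eq_of_arcsin_add_eq_pi (mem (π / 3)) (mem (π / 5))
    (mem (π / k₃)) (mem (π / k₄)) (by linarith)
  have b₁ := cos_pi_div_three
  obtain ⟨b₂, b₂'⟩ := cos_pi_div_five_bounds
  have b₃ := cos_pi_div_six_gt.trans_le (cos_pi_div_le_cos_pi_div (by norm_num) hk₃')
  have b₄ := cos_pi_div_seven_gt.trans_le (cos_pi_div_le_cos_pi_div (by norm_num) hk₄')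
  have b₃' := cos_le_one (π / k₃)
  have b₄' := cos_le_one (π / k₄)
  generalize cos (π / 3) = c₁ at *
  generalize cos (π / 5) = c₂ at *
  generalize cos (π / k₃) = c₃ at *
  generalize cos (π / k₄) = c₄ at *
  constructor <;> by_contra! hlt
  · have s₁ : 0.4545 ≤ c₁ / x := by rw [le_div_iff₀ hx₀]; linarith
    have s₂ : 0.7354 ≤ c₂ / x := by rw [le_div_iff₀ hx₀]; linarith
    have s₃ : 0.787 ≤ c₃ / x := by rw [le_div_iff₀ hx₀]; linarith
    have s₄ : 0.817 ≤ c₄ / x := by rw [le_div_iff₀ hx₀]; linarith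
    have r₁ := sqrt_one_sub_sq_le (c := 0.891) (by norm_num) s₁ (by norm_num) (by norm_num)
    have r₂ := sqrt_one_sub_sq_le (c := 0.678) (by norm_num) s₂ (by norm_num) (by norm_num)
    have r₃ := sqrt_one_sub_sq_le (c := 0.617) (by norm_num) s₃ (by norm_num) (by norm_num)
    have r₄ := sqrt_one_sub_sq_le (c := 0.577) (by norm_num) s₄ (by norm_num) (by norm_num)
    have p₁ := mul_le_mul r₁ r₂ (sqrt_nonneg _) (by norm_num)
    have p₂ := mul_le_mul r₃ r₄ (sqrt_nonneg _) (by norm_num)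
    have p₃ := mul_le_mul s₁ s₂ (by norm_num) (by linarith)
    have p₄ := mul_le_mul s₃ s₄ (by norm_num) (by linarith)
    norm_num at p₁ p₂ p₃ p₄
    linarith
  · have n₁ : 0 ≤ c₁ / x := div_nonneg (by linarith) hx₀.le
    have n₂ : 0 ≤ c₂ / x := div_nonneg (by linarith) hx₀.le
    have n₃ : 0 ≤ c₃ / x := div_nonneg (by linarith) hx₀.le
    have n₄ : 0 ≤ c₄ / x := div_nonneg (by linarith) hx₀.le
    have s₁ : c₁ / x ≤ 5 / 12 := by rw [div_le_iff₀ hx₀]; linarith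
    have s₂ : c₂ / x ≤ 0.6742 := by rw [div_le_iff₀ hx₀]; linarith
    have s₃ : c₃ / x ≤ 5 / 6 := by rw [div_le_iff₀ hx₀]; linarith
    have s₄ : c₄ / x ≤ 5 / 6 := by rw [div_le_iff₀ hx₀]; linarith
    have r₁ := le_sqrt_one_sub_sq (c := 0.909) n₁ s₁ (by norm_num)
    have r₂ := le_sqrt_one_sub_sq (c := 0.7385) n₂ s₂ (by norm_num)
    have r₃ := le_sqrt_one_sub_sq (c := 0.5527) n₃ s₃ (by norm_num)
    have r₄ := le_sqrt_one_sub_sq (c := 0.5527) n₄ s₄ (by norm_num)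
    have p₁ := mul_le_mul r₁ r₂ (by norm_num) (sqrt_nonneg _)
    have p₂ := mul_le_mul r₃ r₄ (by norm_num) (sqrt_nonneg _)
    have p₃ := mul_le_mul s₁ s₂ n₂ (by norm_num)
    have p₄ := mul_le_mul s₃ s₄ n₄ (by norm_num)
    norm_num at p₁ p₂ p₃ p₄
    linarith
end

section
/- Let $m \ge 5$ be an integer, and let $x > 1$ be the (unique) real number satisfying $2\arcsin(\cos(\pi/3)/x) + 2\arcsin(\cos(\pi/4)/x) + 2\arcsin(\cos(\pi/5)/x) + 2\arcsin(\cos(\pi/m)/x) = 2\pi$. Then $x < 1.1$. -/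
open Real

lemma arcsin_div_le_arcsin {c x q r : ℝ} (hr : 0 < r) (hq : 0 ≤ q) (hx : r ≤ x)
    (hc : c ≤ q * r) : arcsin (c / x) ≤ arcsin q := by
  refine monotone_arcsin ?_
  rw [div_le_iff₀ (hr.trans_le hx)]
  exact hc.trans (mul_le_mul_of_nonneg_left hx hq)

lemma le_cos_arcsin {q p : ℝ} (h : p ^ 2 ≤ 1 - q ^ 2) : p ≤ cos (arcsin q) := by
  rw [cos_arcsin]
  exact le_sqrt_of_sq_le h

lemma arcsin_sum_lt_pi :
    arcsin (5 / 11) + arcsin 0.6429 + arcsin 0.7355 + arcsin (10 / 11) < π := by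
  have hA : 0.8907 ≤ cos (arcsin (5 / 11)) := le_cos_arcsin (by norm_num)
  have hB : 0.7659 ≤ cos (arcsin 0.6429) := le_cos_arcsin (by norm_num)
  have hC : 0.6775 ≤ cos (arcsin 0.7355) := le_cos_arcsin (by norm_num)
  have hD : 0.4165 ≤ cos (arcsin (10 / 11)) := le_cos_arcsin (by norm_num)
  have hAD := mul_le_mul hA hD (by norm_num) (by linarith)
  have hBC := mul_le_mul hB hC (by norm_num) (by linarith)
  by_contra! h
  have hcos : cos (arcsin (5 / 11) + arcsin (10 / 11))
      ≤ cos (π - (arcsin 0.6429 + arcsin 0.7355)) := by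
    refine cos_le_cos_of_nonneg_of_le_pi ?_ ?_ (by linarith)
    · linarith [arcsin_le_pi_div_two 0.6429, arcsin_le_pi_div_two 0.7355]
    · linarith [arcsin_le_pi_div_two (5 / 11), arcsin_le_pi_div_two (10 / 11)]
  rw [cos_pi_sub, cos_add, cos_add,
    sin_arcsin (x := 5 / 11) (by norm_num) (by norm_num),
    sin_arcsin (x := 10 / 11) (by norm_num) (by norm_num),
    sin_arcsin (x := 0.6429) (by norm_num) (by norm_num),
    sin_arcsin (x := 0.7355) (by norm_num) (by norm_num)] at hcos
  norm_num at hAD hBC hcos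
  linarith



/-- The side-length parameter `x = cosh(ℓ/2)` of the fan of type `[3, 4, 5, m]`
with `m ≥ 5` satisfies `x < 1.1`. -/
theorem stmt_1 (m : ℤ) (hm : 5 ≤ m)
    (x : ℝ) (hx : 1 < x)
    (heq : 2 * arcsin (cos (π / 3) / x) + 2 * arcsin (cos (π / 4) / x)
        + 2 * arcsin (cos (π / 5) / x) + 2 * arcsin (cos (π / (m : ℝ)) / x)
        = 2 * π) :
    x < 1.1 := by
  by_contra! h
  have h2 : √2 ≤ 1.41422 := sqrt_le_iff.2 (by norm_num)
  have h5 : √5 ≤ 2.2361 := sqrt_le_iff.2 (by norm_num)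
  have hr : (0 : ℝ) < 1.1 := by norm_num
  have hA : arcsin (cos (π / 3) / x) ≤ arcsin (5 / 11) :=
    arcsin_div_le_arcsin hr (by norm_num) h (by rw [cos_pi_div_three]; norm_num)
  have hB : arcsin (cos (π / 4) / x) ≤ arcsin 0.6429 :=
    arcsin_div_le_arcsin hr (by norm_num) h (by rw [cos_pi_div_four]; linarith)
  have hC : arcsin (cos (π / 5) / x) ≤ arcsin 0.7355 :=
    arcsin_div_le_arcsin hr (by norm_num) h (by rw [cos_pi_div_five]; linarith)
  have hD : arcsin (cos (π / (m : ℝ)) / x) ≤ arcsin (10 / 11) :=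
    arcsin_div_le_arcsin hr (by norm_num) h ((cos_le_one _).trans (by norm_num))
  linarith [arcsin_sum_lt_pi]
end

section
/- Let $k_3, k_4, m$ be integers with $6 \le k_3 < k_4$ and $m \ge 5$. Let $x_1 > 1$ satisfy $2\arcsin(\cos(\pi/3)/x_1) + 2\arcsin(\cos(\pi/5)/x_1) + 2\arcsin(\cos(\pi/k_3)/x_1) + 2\arcsin(\cos(\pi/k_4)/x_1) = 2\pi$, and let $x_2 > 1$ satisfy $2\arcsin(\cos(\pi/3)/x_2) + 2\arcsin(\cos(\pi/4)/x_2) + 2\arcsin(\cos(\pi/5)/x_2) + 2\arcsin(\cos(\pi/m)/x_2) = 2\pi$. Then $x_2 < x_1$; in particular the side length $\ell_{[3,5,k_3,k_4]}$ is strictly greater than the side length $\ell_{[3,4,5,m]}$. -/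
open Real

lemma pi_lt_arcsin_add_four {s₁ s₂ s₃ s₄ c₁ c₂ c₃ c₄ : ℝ}
    (hs₁ : 0 ≤ s₁) (hs₂ : 0 ≤ s₂) (hs₃ : 0 ≤ s₃) (hs₄ : 0 ≤ s₄)
    (hs₁' : s₁ ≤ 1) (hs₂' : s₂ ≤ 1) (hs₃' : s₃ ≤ 1) (hs₄' : s₄ ≤ 1)
    (hc₁ : 0 ≤ c₁) (hc₂ : 0 ≤ c₂) (hc₃ : 0 ≤ c₃) (hc₄ : 0 ≤ c₄)
    (h₁ : 1 - s₁ ^ 2 ≤ c₁ ^ 2) (h₂ : 1 - s₂ ^ 2 ≤ c₂ ^ 2)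
    (h₃ : 1 - s₃ ^ 2 ≤ c₃ ^ 2) (h₄ : 1 - s₄ ^ 2 ≤ c₄ ^ 2)
    (h : c₁ * c₂ + c₃ * c₄ < s₁ * s₂ + s₃ * s₄) :
    π < arcsin s₁ + arcsin s₂ + arcsin s₃ + arcsin s₄ := by
  by_contra! hle
  have hcos := cos_le_cos_of_nonneg_of_le_pi
    (add_nonneg (arcsin_nonneg.2 hs₁) (arcsin_nonneg.2 hs₂))
    (by linarith [arcsin_nonneg.2 hs₃, arcsin_nonneg.2 hs₄] :
      π - (arcsin s₃ + arcsin s₄) ≤ π) (by linarith)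
  rw [cos_pi_sub, cos_add, cos_add, sin_arcsin (by linarith) hs₁', sin_arcsin (by linarith) hs₂',
    sin_arcsin (by linarith) hs₃', sin_arcsin (by linarith) hs₄',
    cos_arcsin, cos_arcsin, cos_arcsin, cos_arcsin] at hcos
  have h₁₂ := mul_le_mul (sqrt_le_iff.2 ⟨hc₁, h₁⟩) (sqrt_le_iff.2 ⟨hc₂, h₂⟩) (sqrt_nonneg _) hc₁
  have h₃₄ := mul_le_mul (sqrt_le_iff.2 ⟨hc₃, h₃⟩) (sqrt_le_iff.2 ⟨hc₄, h₄⟩) (sqrt_nonneg _) hc₃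
  linarith

lemma arcsin_add_four_lt_pi {s₁ s₂ s₃ s₄ c₁ c₂ c₃ c₄ : ℝ}
    (hs₁ : 0 ≤ s₁) (hs₂ : 0 ≤ s₂) (hs₃ : 0 ≤ s₃) (hs₄ : 0 ≤ s₄)
    (hs₁' : s₁ ≤ 1) (hs₂' : s₂ ≤ 1) (hs₃' : s₃ ≤ 1) (hs₄' : s₄ ≤ 1)
    (hc₂ : 0 ≤ c₂) (hc₄ : 0 ≤ c₄)
    (h₁ : c₁ ^ 2 ≤ 1 - s₁ ^ 2) (h₂ : c₂ ^ 2 ≤ 1 - s₂ ^ 2)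
    (h₃ : c₃ ^ 2 ≤ 1 - s₃ ^ 2) (h₄ : c₄ ^ 2 ≤ 1 - s₄ ^ 2)
    (h : s₁ * s₂ + s₃ * s₄ < c₁ * c₂ + c₃ * c₄) :
    arcsin s₁ + arcsin s₂ + arcsin s₃ + arcsin s₄ < π := by
  by_contra! hle
  have hcos := cos_le_cos_of_nonneg_of_le_pi
    (by linarith [arcsin_le_pi_div_two s₃, arcsin_le_pi_div_two s₄] :
      0 ≤ π - (arcsin s₃ + arcsin s₄))
    (by linarith [arcsin_le_pi_div_two s₁, arcsin_le_pi_div_two s₂] :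
      arcsin s₁ + arcsin s₂ ≤ π) (by linarith)
  rw [cos_pi_sub, cos_add, cos_add, sin_arcsin (by linarith) hs₁', sin_arcsin (by linarith) hs₂',
    sin_arcsin (by linarith) hs₃', sin_arcsin (by linarith) hs₄',
    cos_arcsin, cos_arcsin, cos_arcsin, cos_arcsin] at hcos
  have h₁₂ := mul_le_mul (le_sqrt_of_sq_le h₁) (le_sqrt_of_sq_le h₂) hc₂ (sqrt_nonneg _)
  have h₃₄ := mul_le_mul (le_sqrt_of_sq_le h₃) (le_sqrt_of_sq_le h₄) hc₄ (sqrt_nonneg _)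
  linarith

lemma cos_pi_div_le_cos_pi_div_s2 {a b : ℝ} (ha : 1 ≤ a) (hab : a ≤ b) :
    cos (π / a) ≤ cos (π / b) :=
  cos_le_cos_of_nonneg_of_le_pi (div_nonneg pi_pos.le (by linarith)) (div_le_self pi_pos.le ha) (by gcongr)

lemma arcsin_le_arcsin_div {s t c x : ℝ} (hs : 0 ≤ s) (hx : 0 < x) (hxc : x ≤ c)
    (h : s * c ≤ t) : arcsin s ≤ arcsin (t / x) :=
  monotone_arcsin ((le_div_iff₀ hx).2 ((mul_le_mul_of_nonneg_left hxc hs).trans h))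

lemma arcsin_div_le_arcsin_s2 {s t c x : ℝ} (hs : 0 ≤ s) (hx : 0 < x) (hcx : c ≤ x)
    (h : t ≤ s * c) : arcsin (t / x) ≤ arcsin s :=
  monotone_arcsin ((div_le_iff₀ hx).2 (h.trans (mul_le_mul_of_nonneg_left hcx hs)))

/-- The side-length parameter of the fan of type `[3, 5, k₃, k₄]` (with `6 ≤ k₃ < k₄`)
is strictly greater than that of the fan of type `[3, 4, 5, m]` (with `m ≥ 5`); in
particular `ℓ_{[3,5,k₃,k₄]} > ℓ_{[3,4,5,m]}`. -/
theorem stmt_2 (k₃ k₄ m : ℤ) (hk₃ : 6 ≤ k₃) (hk₃k₄ : k₃ < k₄) (hm : 5 ≤ m)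
    (x₁ x₂ : ℝ) (hx₁ : 1 < x₁) (hx₂ : 1 < x₂)
    (heq₁ : 2 * arcsin (cos (π / 3) / x₁) + 2 * arcsin (cos (π / 5) / x₁)
        + 2 * arcsin (cos (π / (k₃ : ℝ)) / x₁) + 2 * arcsin (cos (π / (k₄ : ℝ)) / x₁)
        = 2 * π)
    (heq₂ : 2 * arcsin (cos (π / 3) / x₂) + 2 * arcsin (cos (π / 4) / x₂)
        + 2 * arcsin (cos (π / 5) / x₂) + 2 * arcsin (cos (π / (m : ℝ)) / x₂)
        = 2 * π) :
    x₂ < x₁ := by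
  have hx₁0 : 0 < x₁ := by linarith
  have hx₂0 : 0 < x₂ := by linarith
  have hcos5 : 0.809 ≤ cos (π / 5) ∧ cos (π / 5) ≤ 0.8091 := by
    rw [cos_pi_div_five]
    have hl : (2.236 : ℝ) ≤ √5 := le_sqrt_of_sq_le (by norm_num)
    have hu : √5 ≤ (2.2364 : ℝ) := sqrt_le_iff.2 (by norm_num)
    constructor <;> linarith
  have hcos4 : cos (π / 4) ≤ 0.7072 := by
    rw [cos_pi_div_four]
    have hu : √2 ≤ (1.4144 : ℝ) := sqrt_le_iff.2 (by norm_num)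
    linarith
  have hcos6 : 0.866 ≤ cos (π / (k₃ : ℝ)) := by
    refine le_trans ?_ (cos_pi_div_le_cos_pi_div_s2 (a := 6) (by norm_num) (by exact_mod_cast hk₃))
    rw [cos_pi_div_six]
    have hl : (1.732 : ℝ) ≤ √3 := le_sqrt_of_sq_le (by norm_num)
    linarith
  have hcos7 : 0.899 ≤ cos (π / (k₄ : ℝ)) := by
    refine le_trans ?_ (cos_pi_div_le_cos_pi_div_s2 (a := 7) (by norm_num)
      (by exact_mod_cast (by lia : (7 : ℤ) ≤ k₄)))
    refine le_trans ?_ one_sub_sq_div_two_le_cos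
    nlinarith [pi_lt_d4, pi_pos]
  have h₁ : 1.102 < x₁ := by
    by_contra! hle
    have hsum := pi_lt_arcsin_add_four (s₁ := 0.4537) (s₂ := 0.7341) (s₃ := 0.7858) (s₄ := 0.8157)
      (c₁ := 0.8912) (c₂ := 0.6791) (c₃ := 0.6185) (c₄ := 0.5785)
      (by norm_num) (by norm_num) (by norm_num) (by norm_num)
      (by norm_num) (by norm_num) (by norm_num) (by norm_num)
      (by norm_num) (by norm_num) (by norm_num) (by norm_num)
      (by norm_num) (by norm_num) (by norm_num) (by norm_num) (by norm_num)
    have a₁ : arcsin 0.4537 ≤ arcsin (cos (π / 3) / x₁) :=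
      arcsin_le_arcsin_div (by norm_num) hx₁0 hle (by rw [cos_pi_div_three]; norm_num)
    have a₂ : arcsin 0.7341 ≤ arcsin (cos (π / 5) / x₁) :=
      arcsin_le_arcsin_div (by norm_num) hx₁0 hle (by linarith)
    have a₃ : arcsin 0.7858 ≤ arcsin (cos (π / (k₃ : ℝ)) / x₁) :=
      arcsin_le_arcsin_div (by norm_num) hx₁0 hle (by linarith)
    have a₄ : arcsin 0.8157 ≤ arcsin (cos (π / (k₄ : ℝ)) / x₁) :=
      arcsin_le_arcsin_div (by norm_num) hx₁0 hle (by linarith)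
    linarith
  have h₂ : x₂ < 1.102 := by
    by_contra! hle
    have hsum := arcsin_add_four_lt_pi (s₁ := 0.4538) (s₂ := 0.6418) (s₃ := 0.7343) (s₄ := 0.9075)
      (c₁ := 0.8911) (c₂ := 0.7668) (c₃ := 0.6788) (c₄ := 0.42)
      (by norm_num) (by norm_num) (by norm_num) (by norm_num)
      (by norm_num) (by norm_num) (by norm_num) (by norm_num)
      (by norm_num) (by norm_num)
      (by norm_num) (by norm_num) (by norm_num) (by norm_num) (by norm_num)
    have a₁ : arcsin (cos (π / 3) / x₂) ≤ arcsin 0.4538 :=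
      arcsin_div_le_arcsin_s2 (by norm_num) hx₂0 hle (by rw [cos_pi_div_three]; norm_num)
    have a₂ : arcsin (cos (π / 4) / x₂) ≤ arcsin 0.6418 :=
      arcsin_div_le_arcsin_s2 (by norm_num) hx₂0 hle (by linarith)
    have a₃ : arcsin (cos (π / 5) / x₂) ≤ arcsin 0.7343 :=
      arcsin_div_le_arcsin_s2 (by norm_num) hx₂0 hle (by linarith)
    have a₄ : arcsin (cos (π / (m : ℝ)) / x₂) ≤ arcsin 0.9075 :=
      arcsin_div_le_arcsin_s2 (by norm_num) hx₂0 hle (by linarith [cos_le_one (π / (m : ℝ))])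
    linarith
  exact h₂.trans h₁
end

section
/- For every real $x$ with $1.1 \le x \le 1.2$ and every integer $i \ge 3$, one has $2\arcsin(\cos(\pi/3)/x) + 2\arcsin(\cos(\pi/5)/x) > 2\arcsin(\cos(\pi/i)/x)$. In particular, at such a parameter $x$ the inner angle of a regular hyperbolic triangle plus the inner angle of a regular hyperbolic pentagon can never equal the inner angle of a regular hyperbolic $i$-gon. -/
open Real

/-- For `x ∈ [1.1, 1.2]` and every integer `i ≥ 3`, the inner angle of a regular
hyperbolic triangle plus the inner angle of a regular hyperbolic pentagon is strictly
greater than the inner angle of a regular hyperbolic `i`-gon. -/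
theorem stmt_5 (x : ℝ) (hx₁ : 1.1 ≤ x) (hx₂ : x ≤ 1.2) (i : ℤ) (hi : 3 ≤ i) :
    2 * arcsin (cos (π / 3) / x) + 2 * arcsin (cos (π / 5) / x)
      > 2 * arcsin (cos (π / (i : ℝ)) / x) := by
  have hx : 0 < x := by linarith
  have hxx : 1.21 ≤ x ^ 2 := by nlinarith
  rw [cos_pi_div_three]
  obtain ⟨hc, hc'⟩ : 0.8 ≤ cos (π / 5) ∧ cos (π / 5) ≤ 0.81 := by
    rw [cos_pi_div_five]
    have hl : (2.2 : ℝ) ≤ √5 := le_sqrt_of_sq_le (by norm_num)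
    have hu : √5 ≤ (2.24 : ℝ) := sqrt_le_iff.mpr (by norm_num)
    constructor <;> linarith
  generalize cos (π / 5) = c at hc hc'
  have hi_le : arcsin (cos (π / (i : ℝ)) / x) ≤ arcsin (1 / x) :=
    monotone_arcsin (by gcongr; exact cos_le_one _)
  suffices h : arcsin (1 / x) < arcsin (1 / 2 / x) + arcsin (c / x) by linarith
  have ha₀ : 0 ≤ 1 / 2 / x := by positivity
  have hb₀ : 0 ≤ c / x := by positivity
  have ha : 1 / 2 / x ≤ 1 := by rw [div_le_one hx]; linarith
  have hb : c / x ≤ 1 := by rw [div_le_one hx]; linarith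
  by_cases hsum : arcsin (1 / 2 / x) + arcsin (c / x) ≤ π / 2
  · have hA := arcsin_nonneg.mpr ha₀
    have hB := arcsin_nonneg.mpr hb₀
    rw [arcsin_lt_iff_lt_sin' ⟨by linarith [pi_pos], hsum⟩, sin_add,
      sin_arcsin (by linarith) ha, sin_arcsin (by linarith) hb, cos_arcsin, cos_arcsin]
    have hcosB : (0.67 : ℝ) ≤ √(1 - (c / x) ^ 2) := by
      apply le_sqrt_of_sq_le
      have : (c / x) ^ 2 ≤ 0.55 := by
        rw [div_pow, div_le_iff₀ (by positivity)]
        nlinarith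
      linarith
    have hcosA : (0.89 : ℝ) ≤ √(1 - (1 / 2 / x) ^ 2) := by
      apply le_sqrt_of_sq_le
      have : (1 / 2 / x) ^ 2 ≤ 0.207 := by
        rw [div_pow, div_le_iff₀ (by positivity)]
        nlinarith
      linarith
    calc 1 / x < (1 / 2 * 0.67 + 0.89 * 0.8) / x := by gcongr; norm_num
      _ = 1 / 2 / x * 0.67 + 0.89 * (0.8 / x) := by ring
      _ ≤ 1 / 2 / x * √(1 - (c / x) ^ 2) + √(1 - (1 / 2 / x) ^ 2) * (c / x) := by gcongr
  · exact (arcsin_le_pi_div_two _).trans_lt (not_le.mp hsum)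
end

section
/- Let $l, k, l', k'$ be natural numbers and let $x > 1$ be a real number satisfying both $l \cdot 2\arcsin(\cos(\pi/3)/x) + k \cdot 2\arcsin(\cos(\pi/4)/x) = 2\pi$ and $l' \cdot 2\arcsin(\cos(\pi/3)/x) + k' \cdot 2\arcsin(\cos(\pi/4)/x) = 2\pi$. Then $l = l'$ and $k = k'$. Equivalently, the side length of the regular hyperbolic polygons in a fan of type $[3^l, 4^k]$ is uniquely determined by $l$ and $k$. -/
open Real

lemma exists_coprime_mem_second_quarter {n : ℕ} (hn : 6 < n) :
    ∃ j : ℕ, j.Coprime n ∧ n < 4 * j ∧ 2 * j ≤ n := by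
  obtain ⟨m, rfl | rfl | rfl⟩ : ∃ m, n = 2 * m + 1 ∨ n = 4 * m ∨ n = 4 * m + 2 := by
    rcases Nat.even_or_odd' n with ⟨k, hk | hk⟩
    · rcases Nat.even_or_odd' k with ⟨m, hm | hm⟩ <;> exact ⟨m, by omega⟩
    · exact ⟨k, .inl hk⟩
  · exact ⟨m, by simp, by omega, by omega⟩
  · refine ⟨2 * m - 1, ?_, by omega, by omega⟩
    obtain ⟨c, rfl⟩ : ∃ c, m = c + 1 := ⟨m - 1, by omega⟩
    have e : 4 * (c + 1) = 2 + (2 * c + 1) * 2 := by ring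
    rw [show 2 * (c + 1) - 1 = 2 * c + 1 by omega, e]
    simp
  · refine ⟨2 * m - 1, ?_, by omega, by omega⟩
    obtain ⟨c, rfl⟩ : ∃ c, m = c + 1 := ⟨m - 1, by omega⟩
    have h : (2 * c + 1).Coprime (2 ^ 2) := Nat.Coprime.pow_right 2 (by simp)
    have e : 4 * (c + 1) + 2 = 2 ^ 2 + (2 * c + 1) * 2 := by ring
    rw [show 2 * (c + 1) - 1 = 2 * c + 1 by omega, e]
    simpa using h

/-- Galois conjugation of roots of unity: an integral polynomial vanishing at one primitive `n`-th
root of unity vanishes at all of them. -/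
lemma IsPrimitiveRoot.aeval_eq_zero_of_aeval_eq_zero {n : ℕ} {z w : ℂ} (hn : 0 < n)
    (hz : IsPrimitiveRoot z n) (hw : IsPrimitiveRoot w n) {Q : Polynomial ℤ}
    (hQ : Polynomial.aeval z Q = 0) : Polynomial.aeval w Q = 0 := by
  have hdvd := minpoly.isIntegrallyClosed_dvd (hz.isIntegral hn) hQ
  rw [← Polynomial.cyclotomic_eq_minpoly hz hn, Polynomial.cyclotomic_eq_minpoly hw hn] at hdvd
  exact Polynomial.aeval_eq_zero_of_dvd_aeval_eq_zero hdvd (minpoly.aeval ℤ w)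

lemma Complex.exp_ofReal_mul_I_add_pow_pred {n : ℕ} (hn : 0 < n) {t : ℝ}
    (h : Complex.exp (t * Complex.I) ^ n = 1) :
    Complex.exp (t * Complex.I) + Complex.exp (t * Complex.I) ^ (n - 1)
      = ((2 * Real.cos t : ℝ) : ℂ) := by
  have hinv : Complex.exp (t * Complex.I) ^ (n - 1) = Complex.exp (-t * Complex.I) := by
    rw [neg_mul, Complex.exp_neg]
    refine eq_inv_of_mul_eq_one_left ?_
    rw [← pow_succ, Nat.sub_add_cancel hn, h]
  rw [hinv]
  push_cast
  rw [Complex.two_cos]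

/-- If `exp (i α)` and `β` have finite order modulo `2π` and `cos β = 2 cos α - 1`, then
`exp (i α)` has order at most `6`, because all conjugates of `cos α` are nonnegative. -/
lemma orderOf_exp_le_six {α β : ℝ} {m : ℤ} (hm : m ≠ 0)
    (hα : IsOfFinOrder (Complex.exp (α * Complex.I))) (hβ : Real.cos (m * β) = 1)
    (h : Real.cos β = 2 * Real.cos α - 1) :
    orderOf (Complex.exp (α * Complex.I)) ≤ 6 := by
  set z := Complex.exp (α * Complex.I)
  set n := orderOf z
  have hz : IsPrimitiveRoot z n := IsPrimitiveRoot.orderOf z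
  have hn : 0 < n := hα.orderOf_pos
  by_contra! hn6
  obtain ⟨j, hj, hj₁, hj₂⟩ := exists_coprime_mem_second_quarter hn6
  set t : ℝ := 2 * π * (j / n) with ht
  have hw : IsPrimitiveRoot (Complex.exp (t * Complex.I)) n := by
    convert Complex.isPrimitiveRoot_exp_of_coprime j n hn.ne' hj using 2
    push_cast [ht]
    ring
  let Q : Polynomial ℤ :=
    (Polynomial.Chebyshev.T ℤ m).comp (Polynomial.X + Polynomial.X ^ (n - 1) - 1) - 1
  have key : ∀ s : ℝ, Complex.exp (s * Complex.I) ^ n = 1 →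
      Polynomial.aeval (Complex.exp (s * Complex.I)) Q
        = (((Polynomial.Chebyshev.T ℝ m).eval (2 * Real.cos s - 1) - 1 : ℝ) : ℂ) := by
    intro s hs
    simp only [Q, map_sub, map_one, Polynomial.aeval_comp, map_add, map_pow, Polynomial.aeval_X,
      Polynomial.Chebyshev.aeval_T, Complex.exp_ofReal_mul_I_add_pow_pred hn hs]
    push_cast [Polynomial.Chebyshev.complex_ofReal_eval_T]
    rfl
  have hzQ : Polynomial.aeval z Q = 0 := by
    rw [key α hz.pow_eq_one, ← h, Polynomial.Chebyshev.T_real_cos, hβ]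
    simp
  have hwQ := hz.aeval_eq_zero_of_aeval_eq_zero hn hw hzQ
  rw [key t hw.pow_eq_one, Complex.ofReal_eq_zero, sub_eq_zero] at hwQ
  have hbound := (Polynomial.Chebyshev.abs_eval_T_real_le_one_iff hm (2 * Real.cos t - 1)).2
    (by rw [hwQ, abs_one])
  have hn' : (0 : ℝ) < n := by exact_mod_cast hn
  have hcos : Real.cos t < 0 := by
    have h₁ : (1 / 4 : ℝ) < j / n := by
      rw [lt_div_iff₀ hn']
      have : (n : ℝ) < 4 * j := by exact_mod_cast hj₁
      linarith
    have h₂ : (j / n : ℝ) ≤ 1 / 2 := by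
      rw [div_le_iff₀ hn']
      have : (2 * j : ℝ) ≤ n := by exact_mod_cast hj₂
      linarith
    apply Real.cos_neg_of_pi_div_two_lt_of_lt <;> nlinarith [Real.pi_pos]
  linarith [(abs_le.1 hbound).1]

lemma false_of_rational_angles {α β : ℝ} {m a b : ℤ} (hm : m ≠ 0) (hα₀ : 0 < α) (hα₁ : α < π / 3)
    (ha : m * α = a * (2 * π)) (hb : m * β = b * (2 * π))
    (h : Real.cos β = 2 * Real.cos α - 1) : False := by
  have hfin : IsOfFinOrder (Complex.exp (α * Complex.I)) := by
    refine isOfFinOrder_iff_zpow_eq_one.2 ⟨m, hm, ?_⟩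
    rw [← Complex.exp_int_mul, Complex.exp_eq_one_iff]
    refine ⟨a, ?_⟩
    have : (m * α : ℂ) = a * (2 * π) := by exact_mod_cast ha
    linear_combination Complex.I * this
  have hle := orderOf_exp_le_six hm hfin (by rw [hb, Real.cos_int_mul_two_pi]) h
  have hpow := pow_orderOf_eq_one (Complex.exp (α * Complex.I))
  have hpos := hfin.orderOf_pos
  generalize orderOf (Complex.exp (α * Complex.I)) = n at hle hpow hpos
  have hcos : Real.cos (n * α) = 1 := by
    rw [← Complex.exp_nat_mul, ← mul_assoc] at hpow
    rw [← Complex.exp_ofReal_mul_I_re]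
    push_cast
    rw [hpow, Complex.one_re]
  have h₀ : (1 : ℝ) ≤ n := by exact_mod_cast hpos
  have h₆ : (n : ℝ) ≤ 6 := by exact_mod_cast hle
  have hzero := (Real.cos_eq_one_iff_of_lt_of_lt (by nlinarith) (by nlinarith)).1 hcos
  nlinarith

/-- At a fixed side-length parameter `x > 1`, the numbers `l` of triangles and `k`
of quadrilaterals in a fan of type `[3ˡ, 4ᵏ]` are uniquely determined: the side length
of a fan of type `[3ˡ, 4ᵏ]` is uniquely determined by `l` and `k`. -/
theorem stmt_9 (l k l' k' : ℕ) (x : ℝ) (hx : 1 < x)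
    (h₁ : (l : ℝ) * (2 * arcsin (cos (π / 3) / x))
        + (k : ℝ) * (2 * arcsin (cos (π / 4) / x)) = 2 * π)
    (h₂ : (l' : ℝ) * (2 * arcsin (cos (π / 3) / x))
        + (k' : ℝ) * (2 * arcsin (cos (π / 4) / x)) = 2 * π) :
    l = l' ∧ k = k' := by
  have hx₀ : 0 < x := one_pos.trans hx
  have angle_pos : ∀ {c : ℝ}, 0 < c → 0 < 2 * arcsin (c / x) := fun hc =>
    mul_pos two_pos (Real.arcsin_pos.2 (div_pos hc hx₀))
  have cos_angle : ∀ {c : ℝ}, 0 < c → c ≤ 1 →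
      Real.cos (2 * arcsin (c / x)) = 1 - 2 * (c / x) ^ 2 := fun {c} hc hc₁ => by
    have := div_pos hc hx₀
    have : c / x ≤ 1 := by rw [div_le_one hx₀]; linarith
    rw [Real.cos_two_mul, Real.cos_sq', Real.sin_arcsin (by linarith) this]
    ring
  have c₃ : 0 < cos (π / 3) := by rw [Real.cos_pi_div_three]; norm_num
  have c₄ : 0 < cos (π / 4) := by rw [Real.cos_pi_div_four]; positivity
  have hα₀ := angle_pos c₃
  have hβ₀ := angle_pos c₄
  have hα₁ : 2 * arcsin (cos (π / 3) / x) < π / 3 := by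
    have : arcsin (cos (π / 3) / x) < π / 6 := by
      rw [Real.arcsin_lt_iff_lt_sin' ⟨by linarith [Real.pi_pos], by linarith [Real.pi_pos]⟩,
        Real.sin_pi_div_six, Real.cos_pi_div_three]
      exact div_lt_self (by norm_num) hx
    linarith
  have hcos : Real.cos (2 * arcsin (cos (π / 4) / x))
      = 2 * Real.cos (2 * arcsin (cos (π / 3) / x)) - 1 := by
    rw [cos_angle c₃ (Real.cos_le_one _), cos_angle c₄ (Real.cos_le_one _), div_pow, div_pow,
      Real.cos_pi_div_three, Real.cos_pi_div_four, div_pow, Real.sq_sqrt two_pos.le]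
    ring
  generalize 2 * arcsin (cos (π / 3) / x) = α at *
  generalize 2 * arcsin (cos (π / 4) / x) = β at *
  have hdet : (l * k' - l' * k : ℤ) = 0 := by
    by_contra hm
    refine false_of_rational_angles (a := k' - k) (b := l - l') hm hα₀ hα₁ ?_ ?_ hcos
    · push_cast
      linear_combination (k' : ℝ) * h₁ - (k : ℝ) * h₂
    · push_cast
      linear_combination (l : ℝ) * h₂ - (l' : ℝ) * h₁
  have hdet' : (l * k' - l' * k : ℝ) = 0 := by exact_mod_cast hdet
  have hk : 2 * π * ((k' : ℝ) - k) = 0 := by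
    linear_combination α * hdet' - (k' : ℝ) * h₁ + (k : ℝ) * h₂
  have hl : 2 * π * ((l : ℝ) - l') = 0 := by
    linear_combination β * hdet' - (l : ℝ) * h₂ + (l' : ℝ) * h₁
  have hπ := Real.two_pi_pos.ne'
  constructor
  · exact_mod_cast sub_eq_zero.1 ((mul_eq_zero.1 hl).resolve_left hπ)
  · exact_mod_cast (sub_eq_zero.1 ((mul_eq_zero.1 hk).resolve_left hπ)).symm
end
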